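/- Let (M,g) and (M̂,ĝ) be standard P_l(𝓞)-modules of types (r_1,…,r_l) and (r̂_1,…,r̂_l) respectively. Then there exists an 𝓞-linear isomorphism φ : M → M̂ satisfying φ ∘ g = ĝ ∘ φ if and only if r_i = r̂_i for all 1 ≤ i ≤ l. -/

import Mathlib

open NumberField

/-- For an `R`-module endomorphism `g`, `kerPow g i = K_i = ker (g^i)`. -/
def kerPow {R M : Type*} [CommRing R] [AddCommGroup M] [Module R M]
    (g : M →ₗ[R] M) (i : ℕ) : Submodule R M :=
  LinearMap.ker (g ^ i)

/-- `Isub g i j = I_{i,j} = g^{j-i}(K_j) + K_{i-1}`. -/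
def Isub {R M : Type*} [CommRing R] [AddCommGroup M] [Module R M]
    (g : M →ₗ[R] M) (i j : ℕ) : Submodule R M :=
  (kerPow g j).map (g ^ (j - i)) ⊔ kerPow g (i - 1)

/-- `Lsub g i = L_i = g(K_{i+1}) + K_{i-1}`. -/
def Lsub {R M : Type*} [CommRing R] [AddCommGroup M] [Module R M]
    (g : M →ₗ[R] M) (i : ℕ) : Submodule R M :=
  (kerPow g (i + 1)).map g ⊔ kerPow g (i - 1)

/-- `Qquot g i = Q_i = K_i / L_i` as an `R`-module. -/
abbrev Qquot {R M : Type*} [CommRing R] [AddCommGroup M] [Module R M]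
    (g : M →ₗ[R] M) (i : ℕ) :=
  ↥(kerPow g i) ⧸ (Lsub g i).comap (kerPow g i).subtype

section helpers

variable {R M : Type*} [CommRing R] [AddCommGroup M] [Module R M]

lemma mem_kerPow {g : M →ₗ[R] M} {i : ℕ} {x : M} : x ∈ kerPow g i ↔ (g ^ i) x = 0 := by
  simp [kerPow]

lemma pow_apply_succ (g : M →ₗ[R] M) (i : ℕ) (x : M) : (g ^ (i + 1)) x = (g ^ i) (g x) := by
  rw [pow_succ]; rfl

lemma kerPow_mono (g : M →ₗ[R] M) {i j : ℕ} (h : i ≤ j) : kerPow g i ≤ kerPow g j := by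
  intro x hx
  rw [mem_kerPow] at *
  obtain ⟨k, rfl⟩ := Nat.exists_eq_add_of_le' h
  rw [pow_add, Module.End.mul_apply, hx, map_zero]

lemma pow_mem_kerPow (g : M →ₗ[R] M) {i d : ℕ} {x : M} (h : x ∈ kerPow g (i + d)) :
    (g ^ d) x ∈ kerPow g i := by
  rw [mem_kerPow] at *
  rwa [← Module.End.mul_apply, ← pow_add]

/-- Data of lifts of bases of the quotients. -/
structure Lifts (g : M →ₗ[R] M) (l : ℕ) (r : ℕ → ℕ) where
  e : (i : ℕ) → Fin (r i) → M
  ker : ∀ i a, e i a ∈ kerPow g (i + 1)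
  ind : ∀ i, i < l → ∀ c : Fin (r i) → R, ∑ a, c a • e i a ∈ Lsub g (i + 1) → c = 0
  gen : ∀ i, i < l → ∀ x ∈ kerPow g (i + 1), ∃ c : Fin (r i) → R,
    x - ∑ a, c a • e i a ∈ Lsub g (i + 1)

lemma exists_lifts (g : M →ₗ[R] M) (l : ℕ) (r : ℕ → ℕ)
    (B : ∀ i, i < l → Module.Basis (Fin (r i)) R (Qquot g (i + 1))) :
    Nonempty (Lifts g l r) := by
  have hs : ∀ i, ∃ e : Fin (r i) → kerPow g (i + 1), ∀ h : i < l, ∀ a,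
      Submodule.Quotient.mk (e a) = B i h a := by
    intro i
    by_cases h : i < l
    · choose e he using fun a => Submodule.Quotient.mk_surjective _ (B i h a)
      exact ⟨e, fun _ a => he a⟩
    · exact ⟨0, fun h' => absurd h' h⟩
  choose e he using hs
  have key : ∀ i (h : i < l) (c : Fin (r i) → R),
      (Submodule.Quotient.mk (∑ a, c a • e i a) : Qquot g (i + 1)) = ∑ a, c a • B i h a := by
    intro i h c
    rw [← Submodule.mkQ_apply, map_sum]
    refine Finset.sum_congr rfl fun a _ => ?_
    rw [map_smul, Submodule.mkQ_apply, he i h]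
  refine ⟨⟨fun i a => (e i a : M), fun i a => (e i a).2, ?_, ?_⟩⟩
  · intro i h c hc
    have h1 : (Submodule.Quotient.mk (∑ a, c a • e i a) : Qquot g (i + 1)) = 0 := by
      rw [Submodule.Quotient.mk_eq_zero, Submodule.mem_comap]
      simpa using hc
    rw [key i h] at h1
    funext a
    exact Fintype.linearIndependent_iff.1 (B i h).linearIndependent c h1 a
  · intro i h x hx
    refine ⟨(B i h).repr (Submodule.Quotient.mk ⟨x, hx⟩), ?_⟩
    have h1 := key i h ((B i h).repr (Submodule.Quotient.mk ⟨x, hx⟩))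
    rw [(B i h).sum_repr, eq_comm, Submodule.Quotient.eq, Submodule.mem_comap] at h1
    simpa using h1

namespace Lifts

variable {g : M →ₗ[R] M} {l : ℕ} {r : ℕ → ℕ} (E : Lifts g l r)

/-- linear combination of lifts -/
def comb (i : ℕ) (c : Fin (r i) → R) : M := ∑ a, c a • E.e i a

lemma comb_mem (i : ℕ) (c : Fin (r i) → R) : E.comb i c ∈ kerPow g (i + 1) :=
  Submodule.sum_mem _ fun a _ => Submodule.smul_mem _ _ (E.ker i a)

lemma indepA (c : (i : ℕ) → Fin (r i) → R) : ∀ n k, k + n ≤ l →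
    ∑ d ∈ Finset.range n, (g ^ d) (E.comb (k + d) (c (k + d))) ∈ kerPow g k →
    ∀ d < n, c (k + d) = 0 := by
  intro n
  induction n with
  | zero => intro k _ _ d hd; omega
  | succ n ih =>
    intro k hk hsum
    set y := ∑ d ∈ Finset.range n, (g ^ d) (E.comb (k + 1 + d) (c (k + 1 + d))) with hy
    have hy' : ∑ d ∈ Finset.range (n + 1), (g ^ d) (E.comb (k + d) (c (k + d)))
        = g y + E.comb k (c k) := by
      rw [Finset.sum_range_succ', hy, map_sum]
      congr 1
      refine Finset.sum_congr rfl fun d _ => ?_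
      rw [pow_succ', Module.End.mul_apply, show k + 1 + d = k + (d + 1) by ring]
    rw [hy'] at hsum
    have hymem : y ∈ kerPow g (k + 2) := by
      refine Submodule.sum_mem _ fun d _ => pow_mem_kerPow g ?_
      have := E.comb_mem (k + 1 + d) (c (k + 1 + d))
      rwa [show k + 1 + d + 1 = k + 2 + d by ring] at this
    have hc0 : c k = 0 := by
      refine E.ind k (by omega) _ ?_
      have : ∑ a, c k a • E.e k a = g (-y) + (g y + E.comb k (c k)) := by
        rw [map_neg]; simp [comb]
      rw [this]
      exact Submodule.add_mem_sup ⟨-y, neg_mem hymem, rfl⟩ hsum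
    have hy1 : y ∈ kerPow g (k + 1) := by
      have : E.comb k (c k) = 0 := by simp [comb, hc0]
      rw [this, add_zero, mem_kerPow] at hsum
      rwa [mem_kerPow, pow_apply_succ]
    intro d hd
    cases d with
    | zero => exact hc0
    | succ d =>
      have := ih (k + 1) (by omega) hy1 d (by omega)
      rwa [show k + 1 + d = k + (d + 1) by ring] at this

/-- partial sum -/
def lev (c : (i : ℕ) → ℕ → Fin (r i) → R) (k : ℕ) : M :=
  ∑ d ∈ Finset.range (l - k), (g ^ d) (E.comb (k + d) (c (k + d) d))

lemma lev_mem (c : (i : ℕ) → ℕ → Fin (r i) → R) (k : ℕ) : E.lev c k ∈ kerPow g (k + 1) := by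
  refine Submodule.sum_mem _ fun d _ => pow_mem_kerPow g ?_
  have := E.comb_mem (k + d) (c (k + d) d)
  rwa [show k + d + 1 = k + 1 + d by ring] at this

lemma indepB (c : (i : ℕ) → ℕ → Fin (r i) → R) : ∀ n, n ≤ l →
    ∑ k ∈ Finset.range n, E.lev c k = 0 →
    ∀ k < n, ∀ d < l - k, c (k + d) d = 0 := by
  intro n
  induction n with
  | zero => intro _ _ k hk; omega
  | succ n ih =>
    intro hn hsum
    have h1 : E.lev c n ∈ kerPow g n := by
      rw [Finset.sum_range_succ, add_comm] at hsum
      rw [eq_neg_of_add_eq_zero_left hsum]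
      refine neg_mem (Submodule.sum_mem _ fun k hk => ?_)
      exact kerPow_mono g (Finset.mem_range.1 hk) (E.lev_mem c k)
    have h2 : ∀ d < l - n, c (n + d) d = 0 := by
      have := E.indepA (fun i => c i (i - n)) (l - n) n (by omega) (by
        simpa [lev] using h1)
      simpa using this
    have h3 : E.lev c n = 0 := by
      refine Finset.sum_eq_zero fun d hd => ?_
      rw [h2 d (Finset.mem_range.1 hd)]
      simp [comb]
    rw [Finset.sum_range_succ, h3, add_zero] at hsum
    intro k hk
    rcases Nat.lt_succ_iff_lt_or_eq.1 hk with h | rfl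
    · exact ih (by omega) hsum k h
    · exact h2

/-- index type -/
abbrev Idx (l : ℕ) (r : ℕ → ℕ) := Σ k : Fin l, Σ d : Fin (l - k), Fin (r (k + d))

/-- the family -/
def fam (x : Idx l r) : M := (g ^ (x.2.1 : ℕ)) (E.e (x.1 + x.2.1) x.2.2)

lemma fam_indep : LinearIndependent R E.fam := by
  rw [Fintype.linearIndependent_iff]
  intro c hc
  let C' : (k : ℕ) → (d : ℕ) → Fin (r (k + d)) → R := fun k d a =>
    if h : k < l ∧ d < l - k then c ⟨⟨k, h.1⟩, ⟨d, h.2⟩, a⟩ else 0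
  let C : (i : ℕ) → ℕ → Fin (r i) → R := fun i d a =>
    if h : d ≤ i then C' (i - d) d (Fin.cast (by rw [Nat.sub_add_cancel h]) a) else 0
  have hC : ∀ k d, C (k + d) d = C' k d := by
    intro k d
    funext a
    have : ∀ k' (h : k' = k) (h2 : r (k + d) = r (k' + d)), C' k' d (Fin.cast h2 a) = C' k d a := by
      rintro k' rfl h2; rfl
    simp only [C, Nat.le_add_left, dif_pos]
    exact this _ (by omega) _
  have hsum : ∑ k ∈ Finset.range l, E.lev C k = 0 := by
    rw [← hc, Fintype.sum_sigma, ← Fin.sum_univ_eq_sum_range]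
    refine Finset.sum_congr rfl fun k _ => ?_
    rw [Fintype.sum_sigma, lev,
      ← Fin.sum_univ_eq_sum_range (fun d => (g ^ d) (E.comb (k + d) (C (k + d) d)))]
    refine Finset.sum_congr rfl fun d _ => ?_
    rw [hC, comb, map_sum]
    refine Finset.sum_congr rfl fun a _ => ?_
    rw [map_smul]
    simp [C', fam]
  rintro ⟨k, d, a⟩
  have h := E.indepB C l le_rfl hsum k k.2 d d.2
  rw [hC] at h
  have := congrFun h a
  simpa [C'] using this

lemma pow_e_mem_span (i j : ℕ) (hi : i < l) (a : Fin (r i)) :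
    (g ^ j) (E.e i a) ∈ Submodule.span R (Set.range E.fam) := by
  by_cases h : j ≤ i
  · obtain ⟨k, rfl⟩ := Nat.exists_eq_add_of_le' h
    exact Submodule.subset_span ⟨⟨⟨k, by omega⟩, ⟨j, by simp; omega⟩, a⟩, rfl⟩
  · rw [mem_kerPow.1 (kerPow_mono g (by omega) (E.ker i a))]
    exact zero_mem _

lemma g_span_mem {x : M} (hx : x ∈ Submodule.span R (Set.range E.fam)) :
    g x ∈ Submodule.span R (Set.range E.fam) := by
  induction hx using Submodule.span_induction with
  | mem x h =>
    obtain ⟨⟨k, d, a⟩, rfl⟩ := h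
    have := E.pow_e_mem_span (k + d) (d + 1) (by omega) a
    rwa [pow_succ', Module.End.mul_apply] at this
  | zero => simp
  | add x y _ _ h1 h2 => rw [map_add]; exact add_mem h1 h2
  | smul c x _ h => rw [map_smul]; exact Submodule.smul_mem _ _ h

lemma ker_le (hg : g ^ l = 0) : ∀ n i, i + n = l → i < l →
    kerPow g (i + 1) ≤ Submodule.span R (Set.range E.fam) ⊔ kerPow g i := by
  intro n
  induction n with
  | zero => intro i _ _; omega
  | succ n ih =>
    intro i hin hi x hx
    have hL : Lsub g (i + 1) ≤ Submodule.span R (Set.range E.fam) ⊔ kerPow g i := by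
      refine sup_le ?_ le_sup_right
      rintro _ ⟨y, hy, rfl⟩
      have hy' : y ∈ Submodule.span R (Set.range E.fam) ⊔ kerPow g (i + 1) := by
        by_cases h : i + 1 < l
        · exact ih (i + 1) (by omega) h hy
        · have : i + 1 = l := by omega
          refine Submodule.mem_sup_right ?_
          rw [this, mem_kerPow, hg]; rfl
      obtain ⟨s, hs, t, ht, rfl⟩ := Submodule.mem_sup.1 hy'
      rw [map_add]
      refine Submodule.add_mem_sup (E.g_span_mem hs) ?_
      rw [mem_kerPow] at *
      rwa [← pow_apply_succ]
    obtain ⟨c, hc⟩ := E.gen i hi x hx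
    have h2 : ∑ a, c a • E.e i a ∈ Submodule.span R (Set.range E.fam) ⊔ kerPow g i :=
      Submodule.mem_sup_left (Submodule.sum_mem _ fun a _ => Submodule.smul_mem _ _
        (by simpa using E.pow_e_mem_span i 0 hi a))
    have := add_mem (hL hc) h2
    simpa using this

lemma fam_span (hg : g ^ l = 0) : ⊤ ≤ Submodule.span R (Set.range E.fam) := by
  have : ∀ i, i ≤ l → kerPow g i ≤ Submodule.span R (Set.range E.fam) := by
    intro i
    induction i with
    | zero =>
      intro _ x hx
      rw [mem_kerPow] at hx
      have : x = 0 := by simpa using hx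
      rw [this]; exact zero_mem _
    | succ i ih =>
      intro hi
      exact (E.ker_le hg (l - i) i (by omega) (by omega)).trans (sup_le le_rfl (ih (by omega)))
  intro x _
  refine this l le_rfl ?_
  rw [mem_kerPow, hg]; rfl

lemma exists_equiv {M' : Type*} [AddCommGroup M'] [Module R M'] {g' : M' →ₗ[R] M'}
    (E : Lifts g l r) (E' : Lifts g' l r) (hg : g ^ l = 0) (hg' : g' ^ l = 0) :
    ∃ φ : M ≃ₗ[R] M', ∀ x, φ (g x) = g' (φ x) := by
  let b := Module.Basis.mk E.fam_indep (E.fam_span hg)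
  let b' := Module.Basis.mk E'.fam_indep (E'.fam_span hg')
  let φ := b.equiv b' (Equiv.refl _)
  have h1 : ∀ x, φ (E.fam x) = E'.fam x := by
    intro x
    have := b.equiv_apply x b' (Equiv.refl _)
    simpa [b, b', φ] using this
  have h2 : ∀ i j, i < l → ∀ a, φ ((g ^ j) (E.e i a)) = (g' ^ j) (E'.e i a) := by
    intro i j hi a
    by_cases h : j ≤ i
    · obtain ⟨k, rfl⟩ := Nat.exists_eq_add_of_le' h
      exact h1 ⟨⟨k, by omega⟩, ⟨j, by simp; omega⟩, a⟩
    · rw [mem_kerPow.1 (kerPow_mono g (by omega) (E.ker i a)),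
        mem_kerPow.1 (kerPow_mono g' (by omega) (E'.ker i a)), map_zero]
  refine ⟨φ, fun x => ?_⟩
  have : φ.toLinearMap ∘ₗ g = g' ∘ₗ φ.toLinearMap := by
    refine b.ext ?_
    rintro ⟨k, d, a⟩
    have h3 : b ⟨k, d, a⟩ = E.fam ⟨k, d, a⟩ := by simp [b]
    simp only [LinearMap.comp_apply, LinearEquiv.coe_coe]
    rw [h3, h1]
    have := h2 (k + d) (d + 1) (by omega) a
    rwa [pow_succ', pow_succ', Module.End.mul_apply, Module.End.mul_apply] at this
  exact LinearMap.congr_fun this x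

end Lifts

lemma finrank_eq_of_equiv {M' : Type*} [AddCommGroup M'] [Module R M'] {g : M →ₗ[R] M}
    {g' : M' →ₗ[R] M'} (φ : M ≃ₗ[R] M') (h : ∀ x, φ (g x) = g' (φ x)) (i : ℕ) :
    Module.finrank R (Qquot g i) = Module.finrank R (Qquot g' i) := by
  have hp : ∀ j x, φ ((g ^ j) x) = (g' ^ j) (φ x) := by
    intro j
    induction j with
    | zero => simp
    | succ j ih => intro x; rw [pow_apply_succ, pow_apply_succ, ih, h]
  have hk : ∀ j, (kerPow g j).map φ.toLinearMap = kerPow g' j := by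
    intro j
    ext y
    constructor
    · rintro ⟨x, hx, rfl⟩
      have hx' := mem_kerPow.1 hx
      rw [mem_kerPow]
      change (g' ^ j) (φ x) = 0
      rw [← hp, hx', map_zero]
    · intro hy
      refine ⟨φ.symm y, ?_, by simp⟩
      refine mem_kerPow.2 (φ.injective ?_)
      rw [hp, φ.apply_symm_apply, map_zero, mem_kerPow.1 hy]
  have hL : (Lsub g i).map φ.toLinearMap = Lsub g' i := by
    have hc : φ.toLinearMap ∘ₗ g = g' ∘ₗ φ.toLinearMap := LinearMap.ext h
    rw [Lsub, Lsub, Submodule.map_sup, hk, ← Submodule.map_comp, hc, Submodule.map_comp, hk]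
  let ψ : kerPow g i ≃ₗ[R] kerPow g' i := φ.ofSubmodules _ _ (hk i)
  refine LinearEquiv.finrank_eq (Submodule.Quotient.equiv _ _ ψ ?_)
  have hmem : ∀ x, φ x ∈ Lsub g' i ↔ x ∈ Lsub g i := by
    intro x
    rw [← hL]
    constructor
    · rintro ⟨z, hz, hzx⟩
      rwa [← φ.injective hzx]
    · intro hx
      exact ⟨x, hx, rfl⟩
  ext y
  obtain ⟨x, rfl⟩ := ψ.surjective y
  constructor
  · rintro ⟨z, hz, hzx⟩
    rw [← hzx]
    exact (hmem _).2 hz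
  · intro hy
    exact ⟨x, (hmem _).1 hy, rfl⟩

end helpers

lemma exists_lifts_numberField {K : Type*} [Field K] [NumberField K]
    {M : Type*} [AddCommGroup M] [Module (𝓞 K) M] [Module.Finite ℤ M]
    (l : ℕ) (g : M →ₗ[𝓞 K] M)
    (hstd : ∀ i, 1 ≤ i → i ≤ l → Module.Free (𝓞 K) (Qquot g i))
    (r : ℕ → ℕ)
    (hr : ∀ i, 1 ≤ i → i ≤ l → Module.finrank (𝓞 K) (Qquot g i) = r i) :
    Nonempty (Lifts g l (fun i => r (i + 1))) := by
  have : Module.Finite (𝓞 K) M := Module.Finite.of_restrictScalars_finite ℤ _ _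
  refine exists_lifts g l _ fun i hi => ?_
  have := hstd (i + 1) (by omega) (by omega)
  exact Module.finBasisOfFinrankEq _ _ (hr (i + 1) (by omega) (by omega))

/-- Two standard `P_l(𝓞)`-modules `(M,g)` and `(M̂,ĝ)` of types
`(r_1,…,r_l)` and `(r̂_1,…,r̂_l)` are isomorphic as `P_l(𝓞)`-modules (i.e. by an
`𝓞`-linear isomorphism intertwining the endomorphisms) iff `r_i = r̂_i` for all
`1 ≤ i ≤ l`. -/
theorem standard_isomorphic_iff_type_eq
    {K : Type*} [Field K] [NumberField K]
    {M : Type*} [AddCommGroup M] [Module (𝓞 K) M]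
    [Module.Free ℤ M] [Module.Finite ℤ M]
    {Mh : Type*} [AddCommGroup Mh] [Module (𝓞 K) Mh]
    [Module.Free ℤ Mh] [Module.Finite ℤ Mh]
    (l : ℕ) (hl : 1 ≤ l)
    (g : M →ₗ[𝓞 K] M) (hg : g ^ l = 0)
    (gh : Mh →ₗ[𝓞 K] Mh) (hgh : gh ^ l = 0)
    (hstd : ∀ i, 1 ≤ i → i ≤ l → Module.Free (𝓞 K) (Qquot g i))
    (hstdh : ∀ i, 1 ≤ i → i ≤ l → Module.Free (𝓞 K) (Qquot gh i))
    (r rh : ℕ → ℕ)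
    (hr : ∀ i, 1 ≤ i → i ≤ l → Module.finrank (𝓞 K) (Qquot g i) = r i)
    (hrh : ∀ i, 1 ≤ i → i ≤ l → Module.finrank (𝓞 K) (Qquot gh i) = rh i) :
    (∃ φ : M ≃ₗ[𝓞 K] Mh, ∀ x : M, φ (g x) = gh (φ x)) ↔
      (∀ i, 1 ≤ i → i ≤ l → r i = rh i) := by
  constructor
  · rintro ⟨φ, hφ⟩ i h1 h2
    rw [← hr i h1 h2, ← hrh i h1 h2]
    exact finrank_eq_of_equiv φ hφ i
  · intro h
    obtain ⟨E⟩ := exists_lifts_numberField l g hstd r hr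
    obtain ⟨E'⟩ := exists_lifts_numberField l gh hstdh r
      (fun i h1 h2 => (hrh i h1 h2).trans (h i h1 h2).symm)
    exact E.exists_equiv E' hg hgh
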